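/- Under assumptions (A) and (A+), denote J_{s,t}(x) := D_x Φ̄_{s,t}(x). Then for every h ∈ X the map (s, t, x) ↦ J_{s,t}(x) h is continuous from Δ × X to X, where Δ = {(s,t) ∈ I² : s ≤ t}. -/

import Mathlib

open MeasureTheory Set
open scoped RealInnerProductSpace

noncomputable section

/-- `φ` is a mild solution on `[s,T]` with initial data `(s, x)` for the semigroup `S`. -/
def IsMildSol {X : Type*} [NormedAddCommGroup X] [NormedSpace ℝ X]
    (T : ℝ) (S : ℝ → X →L[ℝ] X) (F : ℝ → X → X) (s : ℝ) (x : X) (φ : ℝ → X) : Prop :=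
  ContinuousOn φ (Set.Icc s T) ∧
    ∀ t ∈ Set.Icc s T, φ t = S (t - s) x + ∫ τ in s..t, S (t - τ) (F τ (φ τ))

theorem aux_gronwall {s T a b : ℝ} (hb : 0 < b) (r : ℝ → ℝ)
    (hr : ContinuousOn r (Icc s T)) (h0 : ∀ t ∈ Icc s T, 0 ≤ r t)
    (h : ∀ t ∈ Icc s T, r t ≤ a + b * ∫ τ in s..t, r τ) :
    ∀ t ∈ Icc s T, r t ≤ a * Real.exp (b * (t - s)) := by
  intro t ht
  have hsT : s ≤ T := ht.1.trans ht.2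
  set y : ℝ → ℝ := IccExtend hsT ((Icc s T).domRestrict r) with hy
  have hyc : Continuous y := (continuousOn_iff_continuous_domRestrict.1 hr).Icc_extend'
  have hyr : ∀ t ∈ Icc s T, y t = r t := fun t ht => by
    rw [hy, IccExtend_of_mem hsT _ ht]; rfl
  have hint : ∀ t ∈ Icc s T, ∫ τ in s..t, r τ = ∫ τ in s..t, y τ := by
    intro t ht
    apply intervalIntegral.integral_congr
    intro τ hτ
    rw [uIcc_of_le ht.1] at hτ
    exact (hyr τ ⟨hτ.1, hτ.2.trans ht.2⟩).symm
  have hder : ∀ x, HasDerivAt (fun u => ∫ τ in s..u, y τ) (y x) x := fun x =>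
    (hyc.integral_hasStrictDerivAt s x).hasDerivAt
  have hnn : ∀ x ∈ Icc s T, 0 ≤ ∫ τ in s..x, y τ := by
    intro x hx
    apply intervalIntegral.integral_nonneg hx.1
    intro u hu
    rw [hyr u ⟨hu.1, hu.2.trans hx.2⟩]; exact h0 u ⟨hu.1, hu.2.trans hx.2⟩
  have key := norm_le_gronwallBound_of_norm_deriv_right_le (f := fun u => ∫ τ in s..u, y τ)
    (f' := y) (δ := 0) (K := b) (ε := a) (a := s) (b := T)
    (fun x _ => (hder x).continuousAt.continuousWithinAt)
    (fun x _ => (hder x).hasDerivWithinAt) (by simp)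
    (by
      intro x hx
      have hx' : x ∈ Icc s T := ⟨hx.1, hx.2.le⟩
      rw [Real.norm_of_nonneg (hnn x hx'), hyr x hx', Real.norm_of_nonneg (h0 x hx'), ← hint x hx']
      linarith [h x hx']) t ht
  rw [Real.norm_of_nonneg (hnn t ht), gronwallBound_of_K_ne_0 hb.ne'] at key
  have h1 := h t ht
  rw [hint t ht] at h1
  have h2 := mul_le_mul_of_nonneg_left key hb.le
  have h3 : b * (0 * Real.exp (b * (t - s)) + a / b * (Real.exp (b * (t - s)) - 1))
    = a * Real.exp (b * (t - s)) - a := by field_simp; ring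
  linarith

theorem aux_carath {Y Z : Type*} [NormedAddCommGroup Y] [NormedAddCommGroup Z]
    {μ : Measure ℝ} (H : ℝ → Y → Z) (hm : ∀ v, AEStronglyMeasurable (fun τ => H τ v) μ)
    (hc : ∀ᵐ τ ∂μ, Continuous (H τ)) (g : ℝ → Y) (hg : AEStronglyMeasurable g μ) :
    AEStronglyMeasurable (fun τ => H τ (g τ)) μ := by
  classical
  obtain ⟨g', hg', hgg⟩ := hg
  have hs : ∀ k : SimpleFunc ℝ Y, AEStronglyMeasurable (fun τ => H τ (k τ)) μ := by
    intro k
    have : (fun τ => H τ (k τ)) =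
        fun τ => ∑ v ∈ k.range, (k ⁻¹' {v}).indicator (fun τ => H τ v) τ := by
      funext τ
      rw [Finset.sum_eq_single (k τ)]
      · simp
      · intro v _ hv
        apply indicator_of_notMem
        simpa using hv.symm
      · intro hn
        exact absurd (k.mem_range_self τ) hn
    rw [this]
    apply Finset.aestronglyMeasurable_fun_sum
    intro v _
    exact (hm v).indicator (k.measurableSet_fiber v)
  have h2 : AEStronglyMeasurable (fun τ => H τ (g' τ)) μ := by
    apply aestronglyMeasurable_of_tendsto_ae Filter.atTop (fun n => hs (hg'.approx n))
    filter_upwards [hc] with τ hτ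
    exact (hτ.tendsto _).comp (hg'.tendsto_approx τ)
  apply h2.congr
  filter_upwards [hgg] with τ hτ
  rw [hτ]

theorem aux_second_order {Y Z : Type*} [NormedAddCommGroup Y] [NormedSpace ℝ Y]
    [NormedAddCommGroup Z] [NormedSpace ℝ Z] {f : Y → Z} {M : ℝ}
    (hd : Differentiable ℝ f) (hM : 0 ≤ M)
    (hl : ∀ x y, ‖fderiv ℝ f x - fderiv ℝ f y‖ ≤ M * ‖x - y‖) (x d : Y) :
    ‖f (x + d) - f x - fderiv ℝ f x d‖ ≤ M * ‖d‖ ^ 2 := by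
  have := Convex.norm_image_sub_le_of_norm_fderiv_le' (𝕜 := ℝ) (f := f) (C := M * ‖d‖)
    (s := Metric.closedBall x ‖d‖) (x := x) (y := x + d) (φ := fderiv ℝ f x)
    (fun z _ => hd z) (by
      intro z hz
      refine (hl z x).trans ?_
      rw [mem_closedBall_iff_norm] at hz
      gcongr) (convex_closedBall _ _) (by simp) (by simp)
  simpa [pow_two, mul_assoc] using this

/-- abstract construction of the derivative from almost linearity -/
theorem aux_linear {Y Z : Type*} [NormedAddCommGroup Y] [NormedSpace ℝ Y]
    [NormedAddCommGroup Z] [NormedSpace ℝ Z] [CompleteSpace Z] (D : Y → Z) {L C : ℝ}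
    (hL : ∀ k, ‖D k‖ ≤ L * ‖k‖)
    (hD : ∀ (a b : ℝ) (h k : Y), ‖D (a • h + b • k) - a • D h - b • D k‖ ≤
      C * (‖a • h + b • k‖ ^ 2 + |a| * ‖h‖ ^ 2 + |b| * ‖k‖ ^ 2)) :
    ∃ J : Y →L[ℝ] Z, ∀ k, ‖D k - J k‖ ≤ 3 * C * ‖k‖ ^ 2 := by
  let q : Y → ℕ → Z := fun h n => (2 ^ n : ℝ) • D ((1 / 2 ^ n : ℝ) • h)
  have hq : ∀ h n, dist (q h n) (q h (n + 1)) ≤ (3 * C * ‖h‖ ^ 2) / 2 / 2 ^ n := by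
    intro h n
    have h1 := hD (1 / 2) 0 ((1 / 2 ^ n : ℝ) • h) 0
    have e1 : (1 / 2 : ℝ) • ((1 / 2 ^ n : ℝ) • h) + (0 : ℝ) • (0 : Y) =
      (1 / 2 ^ (n + 1) : ℝ) • h := by
      rw [smul_smul, smul_zero, add_zero, pow_succ]; congr 1; field_simp
    rw [e1] at h1
    have e2 : q h (n + 1) - q h n = (2 ^ (n + 1) : ℝ) •
      (D ((1 / 2 ^ (n + 1) : ℝ) • h) - (1 / 2 : ℝ) • D ((1 / 2 ^ n : ℝ) • h) - (0 : ℝ) • D 0) := by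
      simp only [q, zero_smul, sub_zero, smul_sub, smul_smul]
      congr 2; rw [pow_succ]; ring
    rw [dist_comm, dist_eq_norm, e2, norm_smul, Real.norm_of_nonneg (by positivity)]
    refine (mul_le_mul_of_nonneg_left h1 (by positivity)).trans (le_of_eq ?_)
    simp only [norm_smul, abs_zero, norm_div, norm_one, norm_pow, Real.norm_ofNat,
      abs_of_pos (one_half_pos (α := ℝ))]
    rw [pow_succ]; field_simp; ring
  have hlim : ∀ h, ∃ z, Filter.Tendsto (q h) Filter.atTop (nhds z) := fun h =>
    cauchySeq_tendsto_of_complete (cauchySeq_of_le_geometric_two (hq h))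
  choose J hJ using hlim
  have hlin : ∀ (a b : ℝ) (h k : Y), J (a • h + b • k) = a • J h + b • J k := by
    intro a b h k
    set B := C * (‖a • h + b • k‖ ^ 2 + |a| * ‖h‖ ^ 2 + |b| * ‖k‖ ^ 2)
    have t1 : Filter.Tendsto (fun n => q (a • h + b • k) n - (a • q h n + b • q k n))
        Filter.atTop (nhds (J (a • h + b • k) - (a • J h + b • J k))) :=
      (hJ _).sub (((hJ h).const_smul a).add ((hJ k).const_smul b))
    have t2 : Filter.Tendsto (fun n => q (a • h + b • k) n - (a • q h n + b • q k n))
        Filter.atTop (nhds 0) := by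
      have hb : Filter.Tendsto (fun n : ℕ => B * (1 / 2 : ℝ) ^ n) Filter.atTop (nhds 0) := by
        simpa using (tendsto_pow_atTop_nhds_zero_of_lt_one (by norm_num : (0:ℝ) ≤ 1 / 2)
          (by norm_num)).const_mul B
      refine squeeze_zero_norm (fun n => ?_) hb
      have h1 := hD a b ((1 / 2 ^ n : ℝ) • h) ((1 / 2 ^ n : ℝ) • k)
      have e1 : a • ((1 / 2 ^ n : ℝ) • h) + b • ((1 / 2 ^ n : ℝ) • k) =
          (1 / 2 ^ n : ℝ) • (a • h + b • k) := by
        rw [smul_add, smul_comm a, smul_comm b]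
      rw [e1] at h1
      have e2 : q (a • h + b • k) n - (a • q h n + b • q k n) = (2 ^ n : ℝ) •
        (D ((1 / 2 ^ n : ℝ) • (a • h + b • k)) - a • D ((1 / 2 ^ n : ℝ) • h)
          - b • D ((1 / 2 ^ n : ℝ) • k)) := by
        simp only [q, smul_sub, smul_comm a, smul_comm b]
        abel
      rw [e2, norm_smul, Real.norm_of_nonneg (by positivity)]
      refine (mul_le_mul_of_nonneg_left h1 (by positivity)).trans (le_of_eq ?_)
      simp only [B]
      rw [norm_smul _ (a • h + b • k), norm_smul _ h, norm_smul _ k,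
        Real.norm_of_nonneg (show (0:ℝ) ≤ 1 / 2 ^ n by positivity)]
      rw [one_div_pow]
      field_simp
    exact sub_eq_zero.1 (tendsto_nhds_unique t1 t2)
  have hJb : ∀ h, ‖J h‖ ≤ L * ‖h‖ := by
    intro h
    refine le_of_tendsto (hJ h).norm (Filter.Eventually.of_forall fun n => ?_)
    simp only [q]
    rw [norm_smul, Real.norm_of_nonneg (by positivity)]
    refine (mul_le_mul_of_nonneg_left (hL _) (by positivity)).trans (le_of_eq ?_)
    rw [norm_smul, Real.norm_of_nonneg (by positivity)]
    field_simp
  let Jl : Y →ₗ[ℝ] Z :=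
    { toFun := J
      map_add' := fun h k => by simpa using hlin 1 1 h k
      map_smul' := fun a h => by simpa using hlin a 0 h 0 }
  refine ⟨Jl.mkContinuous L hJb, fun k => ?_⟩
  have := dist_le_of_le_geometric_two_of_tendsto₀ (hq k) (hJ k)
  rw [dist_eq_norm] at this
  have e : Jl.mkContinuous L hJb k = J k := rfl
  rw [e]
  simpa [q] using this

/-- stability estimate for Volterra type equations -/
theorem aux_core {X : Type*} [NormedAddCommGroup X] [NormedSpace ℝ X]
    {T N K : ℝ} (hN : 0 < N) (hK : 0 < K) (S : ℝ → X →L[ℝ] X)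
    (hSN : ∀ σ ∈ Icc 0 T, ‖S σ‖ ≤ N)
    {s : ℝ} (hs : s ∈ Icc 0 T) (z w g : ℝ → X) {a c : ℝ} (ha : 0 ≤ a) (hc : 0 ≤ c)
    (hz : ContinuousOn z (Icc s T))
    (hzw : ∀ t ∈ Icc s T, z t = w t + ∫ τ in s..t, S (t - τ) (g τ))
    (hw : ∀ t ∈ Icc s T, ‖w t‖ ≤ a)
    (hg : ∀ᵐ τ, τ ∈ Icc s T → ‖g τ‖ ≤ K * ‖z τ‖ + c) :
    ∀ t ∈ Icc s T, ‖z t‖ ≤ (a + N * c * T) * Real.exp (N * K * T) := by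
  intro t ht
  have hT : 0 ≤ T := hs.1.trans hs.2
  have key := aux_gronwall (a := a + N * c * T) (b := N * K) (by positivity) (fun t => ‖z t‖)
    hz.norm (fun t _ => norm_nonneg _) (by
      intro t ht
      rw [hzw t ht]
      refine (norm_add_le _ _).trans ?_
      have hzi : IntervalIntegrable (fun τ => ‖z τ‖) volume s t :=
        (hz.norm.mono (Icc_subset_Icc_right ht.2)).intervalIntegrable_of_Icc ht.1
      have h1 : ‖∫ τ in s..t, S (t - τ) (g τ)‖ ≤ ∫ τ in s..t, (N * K * ‖z τ‖ + N * c) := by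
        apply intervalIntegral.norm_integral_le_of_norm_le ht.1
        · filter_upwards [hg] with τ hτ hm
          have hb := hτ ⟨hm.1.le, hm.2.trans ht.2⟩
          calc ‖S (t - τ) (g τ)‖ ≤ ‖S (t - τ)‖ * ‖g τ‖ := (S (t - τ)).le_opNorm _
            _ ≤ N * (K * ‖z τ‖ + c) := by
                gcongr
                apply hSN
                constructor <;> linarith [hm.1, hm.2, ht.2, hs.1]
            _ = _ := by ring
        · exact (hzi.const_mul _).add intervalIntegrable_const
      rw [intervalIntegral.integral_add (hzi.const_mul _) intervalIntegrable_const,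
        intervalIntegral.integral_const_mul, intervalIntegral.integral_const, smul_eq_mul] at h1
      have h2 : (t - s) * (N * c) ≤ T * (N * c) := by
        gcongr; linarith [ht.2, hs.1]
      have := hw t ht
      linarith) t ht
  refine key.trans ?_
  gcongr
  linarith [ht.2, hs.1]

/-- standing assumptions, in reduced form -/
structure AuxSetup {X : Type*} [NormedAddCommGroup X] [NormedSpace ℝ X]
    (T N K : ℝ) (S : ℝ → X →L[ℝ] X) (F : ℝ → X → X) : Prop where
  hT : 0 < T
  hN : 0 < N
  hK : 0 < K
  hS0 : S 0 = ContinuousLinearMap.id ℝ X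
  hSadd : ∀ a b : ℝ, 0 ≤ a → 0 ≤ b → S (a + b) = (S a).comp (S b)
  hScont : ∀ x : X, ContinuousOn (fun σ => S σ x) (Set.Ici (0 : ℝ))
  hSN : ∀ σ ∈ Icc 0 T, ‖S σ‖ ≤ N
  hFm : ∀ x, AEStronglyMeasurable (fun t => F t x) (volume.restrict (Set.Icc (0:ℝ) T))
  hFl : ∀ᵐ t, t ∈ Icc 0 T → ∀ x y, ‖F t x - F t y‖ ≤ K * ‖x - y‖
  hFb : ∀ᵐ t, t ∈ Icc 0 T → ∀ x, ‖F t x‖ ≤ K * ‖x‖ + K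
  hFd : ∀ᵐ t, t ∈ Icc 0 T → ∀ x, ∃ A : X →L[ℝ] X, ‖A‖ ≤ K ∧
    ∀ d, ‖F t (x + d) - F t x - A d‖ ≤ K * ‖d‖ ^ 2

theorem AuxSetup.integrable {X : Type*} [NormedAddCommGroup X] [NormedSpace ℝ X]
    {T N K : ℝ} {S : ℝ → X →L[ℝ] X} {F : ℝ → X → X} (H : AuxSetup T N K S F)
    {s t : ℝ} (hs : s ∈ Icc 0 T) (ht : t ∈ Icc s T) (φ : ℝ → X)
    (hφ : ContinuousOn φ (Icc s T)) :
    IntervalIntegrable (fun τ => S (t - τ) (F τ (φ τ))) volume s t := by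
  have hN := H.hN
  have hK := H.hK
  rw [intervalIntegrable_iff_integrableOn_Ioc_of_le ht.1]
  have hsub : Ioc s t ⊆ Icc 0 T := fun τ hτ =>
    ⟨hs.1.trans hτ.1.le, hτ.2.trans ht.2⟩
  have hsub2 : Ioc s t ⊆ Icc s T := fun τ hτ => ⟨hτ.1.le, hτ.2.trans ht.2⟩
  obtain ⟨B, hB⟩ := (isCompact_Icc.image_of_continuousOn hφ.norm).bddAbove
  have m1 : AEStronglyMeasurable (fun τ => F τ (φ τ)) (volume.restrict (Ioc s t)) := by
    apply aux_carath F (fun v => (H.hFm v).mono_measure (Measure.restrict_mono hsub le_rfl))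
    · rw [ae_restrict_iff' measurableSet_Ioc]
      filter_upwards [H.hFl] with τ hτ hm
      have : LipschitzWith ⟨K, hK.le⟩ (F τ) := by
        apply LipschitzWith.of_dist_le_mul
        intro x y
        rw [dist_eq_norm, dist_eq_norm]
        exact hτ (hsub hm) x y
      exact this.continuous
    · exact (hφ.mono hsub2).aestronglyMeasurable measurableSet_Ioc
  have m2 : AEStronglyMeasurable (fun τ => S (t - τ) (F τ (φ τ))) (volume.restrict (Ioc s t)) := by
    apply aux_carath (fun τ v => S (t - τ) v) _ _ _ m1
    · intro v
      apply ContinuousOn.aestronglyMeasurable _ measurableSet_Ioc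
      apply (H.hScont v).comp (by fun_prop)
      intro τ hτ
      simpa using hτ.2
    · exact Filter.Eventually.of_forall fun τ => (S (t - τ)).continuous
  refine Integrable.of_bound m2 (N * (K * B + K)) ?_
  rw [ae_restrict_iff' measurableSet_Ioc]
  filter_upwards [H.hFb] with τ hτ hm
  calc ‖S (t - τ) (F τ (φ τ))‖ ≤ ‖S (t - τ)‖ * ‖F τ (φ τ)‖ := (S (t - τ)).le_opNorm _
    _ ≤ N * (K * ‖φ τ‖ + K) := by
        gcongr
        · apply H.hSN
          constructor <;> linarith [hm.1, hm.2, ht.2, hs.1]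
        · exact hτ (hsub hm) _
    _ ≤ _ := by
        gcongr
        exact hB (mem_image_of_mem _ (hsub2 hm))

section
variable {X : Type*} [NormedAddCommGroup X] [NormedSpace ℝ X]
    {T N K : ℝ} {S : ℝ → X →L[ℝ] X} {F : ℝ → X → X}

theorem AuxSetup.growth (H : AuxSetup T N K S F) {s : ℝ} (hs : s ∈ Icc 0 T) {x : X} {φ : ℝ → X}
    (hφ : IsMildSol T S F s x φ) :
    ∀ t ∈ Icc s T, ‖φ t‖ ≤ (N * ‖x‖ + N * K * T) * Real.exp (N * K * T) := by
  have hN := H.hN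
  have hK := H.hK
  refine aux_core hN hK S H.hSN hs φ (fun t => S (t - s) x) (fun τ => F τ (φ τ))
    (by positivity) hK.le hφ.1 hφ.2 ?_ ?_
  · intro t ht
    refine ((S (t - s)).le_opNorm _).trans ?_
    gcongr
    apply H.hSN
    constructor <;> linarith [ht.1, ht.2, hs.1]
  · filter_upwards [H.hFb] with τ hτ hm
    exact hτ ⟨hs.1.trans hm.1, hm.2⟩ _

theorem AuxSetup.lip (H : AuxSetup T N K S F) {s : ℝ} (hs : s ∈ Icc 0 T) {x y : X} {φ ψ : ℝ → X}
    (hφ : IsMildSol T S F s x φ) (hψ : IsMildSol T S F s y ψ) :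
    ∀ t ∈ Icc s T, ‖φ t - ψ t‖ ≤ N * Real.exp (N * K * T) * ‖x - y‖ := by
  have hN := H.hN
  have hK := H.hK
  intro t ht
  have := aux_core hN hK S H.hSN hs (fun t => φ t - ψ t) (fun t => S (t - s) (x - y))
    (fun τ => F τ (φ τ) - F τ (ψ τ)) (a := N * ‖x - y‖) (c := 0)
    (by positivity) le_rfl (hφ.1.sub hψ.1) ?_ ?_ ?_ t ht
  · refine this.trans (le_of_eq (by ring))
  · intro t ht
    simp only [map_sub]
    rw [intervalIntegral.integral_sub (H.integrable hs ht φ hφ.1) (H.integrable hs ht ψ hψ.1),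
      hφ.2 t ht, hψ.2 t ht]
    abel
  · intro t ht
    refine ((S (t - s)).le_opNorm _).trans ?_
    gcongr
    apply H.hSN
    constructor <;> linarith [ht.1, ht.2, hs.1]
  · filter_upwards [H.hFl] with τ hτ hm
    simpa using hτ ⟨hs.1.trans hm.1, hm.2⟩ _ _

theorem AuxSetup.quad (H : AuxSetup T N K S F) {s : ℝ} (hs : s ∈ Icc 0 T) {x h k : X} {a b : ℝ}
    {φ p q r : ℝ → X}
    (hφ : IsMildSol T S F s x φ) (hp : IsMildSol T S F s (x + (a • h + b • k)) p)
    (hq : IsMildSol T S F s (x + h) q) (hr : IsMildSol T S F s (x + k) r) :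
    ∀ t ∈ Icc s T, ‖(p t - φ t) - a • (q t - φ t) - b • (r t - φ t)‖ ≤
      (N * (K * (N * Real.exp (N * K * T)) ^ 2) * T * Real.exp (N * K * T)) *
      (‖a • h + b • k‖ ^ 2 + |a| * ‖h‖ ^ 2 + |b| * ‖k‖ ^ 2) := by
  have hN := H.hN
  have hK := H.hK
  have hT := H.hT
  intro t ht
  set L := N * Real.exp (N * K * T) with hL
  have hL0 : 0 < L := by positivity
  set Q := (‖a • h + b • k‖ ^ 2 + |a| * ‖h‖ ^ 2 + |b| * ‖k‖ ^ 2) with hQ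
  have hQ0 : 0 ≤ Q := by positivity
  have hpb := H.lip hs hp hφ
  have hqb := H.lip hs hq hφ
  have hrb := H.lip hs hr hφ
  simp only [add_sub_cancel_left] at hpb hqb hrb
  have := aux_core hN hK S H.hSN hs
    (fun t => (p t - φ t) - a • (q t - φ t) - b • (r t - φ t)) (fun t => 0)
    (fun τ => (F τ (p τ) - F τ (φ τ)) - a • (F τ (q τ) - F τ (φ τ)) - b • (F τ (r τ) - F τ (φ τ)))
    (a := 0) (c := K * L ^ 2 * Q)
    le_rfl (by positivity) (((hp.1.sub hφ.1).sub ((hq.1.sub hφ.1).const_smul a)).sub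
      ((hr.1.sub hφ.1).const_smul b)) ?_ ?_ ?_ t ht
  · refine this.trans (le_of_eq (by ring))
  · intro t ht
    have iφ := H.integrable hs ht φ hφ.1
    have ip := H.integrable hs ht p hp.1
    have iq := H.integrable hs ht q hq.1
    have ir := H.integrable hs ht r hr.1
    simp only [map_sub, map_smul]
    have iq' : IntervalIntegrable (fun τ => a • (S (t - τ) (F τ (q τ)) - S (t - τ) (F τ (φ τ))))
      volume s t := (iq.sub iφ).smul a
    have ir' : IntervalIntegrable (fun τ => b • (S (t - τ) (F τ (r τ)) - S (t - τ) (F τ (φ τ))))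
      volume s t := (ir.sub iφ).smul b
    rw [intervalIntegral.integral_sub ((ip.sub iφ).sub iq') ir',
      intervalIntegral.integral_sub (ip.sub iφ) iq',
      intervalIntegral.integral_sub ip iφ,
      intervalIntegral.integral_smul, intervalIntegral.integral_smul,
      intervalIntegral.integral_sub iq iφ, intervalIntegral.integral_sub ir iφ,
      hφ.2 t ht, hp.2 t ht, hq.2 t ht, hr.2 t ht]
    simp only [map_add, map_smul]
    module
  · intro t ht
    simp
  · filter_upwards [H.hFd] with τ hτ hm
    obtain ⟨A, hA, hAd⟩ := hτ ⟨hs.1.trans hm.1, hm.2⟩ (φ τ)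
    have h1 := hAd (p τ - φ τ)
    have h2 := hAd (q τ - φ τ)
    have h3 := hAd (r τ - φ τ)
    simp only [add_sub_cancel] at h1 h2 h3
    have b1 : K * ‖p τ - φ τ‖ ^ 2 ≤ K * (L * ‖a • h + b • k‖) ^ 2 := by
      gcongr; exact hpb τ hm
    have b2 : K * ‖q τ - φ τ‖ ^ 2 ≤ K * (L * ‖h‖) ^ 2 := by
      gcongr; exact hqb τ hm
    have b3 : K * ‖r τ - φ τ‖ ^ 2 ≤ K * (L * ‖k‖) ^ 2 := by
      gcongr; exact hrb τ hm
    have e : (F τ (p τ) - F τ (φ τ)) - a • (F τ (q τ) - F τ (φ τ)) - b • (F τ (r τ) - F τ (φ τ))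
      = A ((p τ - φ τ) - a • (q τ - φ τ) - b • (r τ - φ τ))
        + ((F τ (p τ) - F τ (φ τ) - A (p τ - φ τ)) - a • (F τ (q τ) - F τ (φ τ) - A (q τ - φ τ))
          - b • (F τ (r τ) - F τ (φ τ) - A (r τ - φ τ))) := by
      simp only [map_sub, map_smul]
      module
    rw [e]
    refine (norm_add_le _ _).trans ?_
    refine add_le_add ((A.le_opNorm _).trans (by gcongr)) ?_
    refine (norm_sub_le _ _).trans ((add_le_add_left (norm_sub_le _ _) _).trans ?_)
    rw [norm_smul, norm_smul, Real.norm_eq_abs, Real.norm_eq_abs]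
    calc _ ≤ K * (L * ‖a • h + b • k‖) ^ 2 + |a| * (K * (L * ‖h‖) ^ 2)
          + |b| * (K * (L * ‖k‖) ^ 2) := by
          gcongr
          · exact h1.trans b1
          · exact h2.trans b2
          · exact h3.trans b3
      _ = _ := by rw [hQ]; ring

/-- size of an integral piece -/
theorem AuxSetup.piece (H : AuxSetup T N K S F) {s : ℝ} (hs : s ∈ Icc 0 T) {x : X} {φ : ℝ → X}
    (hφ : IsMildSol T S F s x φ) {s' t : ℝ} (hs' : s ≤ s') (ht : s' ≤ t) (htT : t ≤ T) :
    ‖∫ τ in s..s', S (t - τ) (F τ (φ τ))‖ ≤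
      N * (K * ((N * ‖x‖ + N * K * T) * Real.exp (N * K * T)) + K) * (s' - s) := by
  have hN := H.hN
  have hK := H.hK
  have hb := H.growth hs hφ
  set B := (N * ‖x‖ + N * K * T) * Real.exp (N * K * T)
  have : ‖∫ τ in s..s', S (t - τ) (F τ (φ τ))‖ ≤ ∫ τ in s..s', N * (K * B + K) := by
    apply intervalIntegral.norm_integral_le_of_norm_le hs'
    · filter_upwards [H.hFb] with τ hτ hm
      have hm' : τ ∈ Icc s T := ⟨hm.1.le, hm.2.trans (ht.trans htT)⟩
      calc ‖S (t - τ) (F τ (φ τ))‖ ≤ ‖S (t - τ)‖ * ‖F τ (φ τ)‖ := (S (t - τ)).le_opNorm _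
        _ ≤ N * (K * ‖φ τ‖ + K) := by
            gcongr
            · apply H.hSN
              constructor <;> linarith [hm.1, hm.2, hs.1]
            · exact hτ ⟨hs.1.trans hm'.1, hm'.2⟩ _
        _ ≤ _ := by
            gcongr
            exact hb τ hm'
    · exact intervalIntegrable_const
  refine this.trans (le_of_eq ?_)
  rw [intervalIntegral.integral_const, smul_eq_mul]; ring

theorem AuxSetup.start (H : AuxSetup T N K S F) (x : X) : ∃ C, 0 ≤ C ∧
    ∀ s ∈ Icc 0 T, ∀ φ, IsMildSol T S F s x φ → ∀ t ∈ Icc s T,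
      ‖φ t - x‖ ≤ ‖S (t - s) x - x‖ + C * (t - s) := by
  have hN := H.hN
  have hK := H.hK
  have hT := H.hT
  refine ⟨N * (K * ((N * ‖x‖ + N * K * T) * Real.exp (N * K * T)) + K), by positivity, ?_⟩
  intro s hs φ hφ t ht
  rw [hφ.2 t ht, add_sub_right_comm]
  exact (norm_add_le _ _).trans (add_le_add le_rfl (H.piece hs hφ ht.1 le_rfl ht.2))

theorem AuxSetup.shift (H : AuxSetup T N K S F) (x : X) : ∃ C, 0 ≤ C ∧
    ∀ s ∈ Icc 0 T, ∀ s' ∈ Icc s T, ∀ φ ψ, IsMildSol T S F s x φ → IsMildSol T S F s' x ψ →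
     ∀ t ∈ Icc s' T,
      ‖φ t - ψ t‖ ≤ C * (‖S (s' - s) x - x‖ + (s' - s)) := by
  have hN := H.hN
  have hK := H.hK
  have hT := H.hT
  set P := N * (K * ((N * ‖x‖ + N * K * T) * Real.exp (N * K * T)) + K) with hP
  have hP0 : 0 < P := by positivity
  refine ⟨(N + P) * Real.exp (N * K * T), by positivity, ?_⟩
  intro s hs s' hs' φ ψ hφ hψ t ht
  have hs0 : s' ∈ Icc 0 T := ⟨hs.1.trans hs'.1, hs'.2⟩
  have hd : 0 ≤ s' - s := by linarith [hs'.1]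
  have := aux_core hN hK S H.hSN hs0 (fun t => φ t - ψ t)
    (fun t => S (t - s') (S (s' - s) x - x) + ∫ τ in s..s', S (t - τ) (F τ (φ τ)))
    (fun τ => F τ (φ τ) - F τ (ψ τ)) (a := N * ‖S (s' - s) x - x‖ + P * (s' - s)) (c := 0)
    (by positivity) le_rfl ((hφ.1.mono (Icc_subset_Icc_left hs'.1)).sub hψ.1) ?_ ?_ ?_ t ht
  · refine this.trans ?_
    have h1 : N * ‖S (s' - s) x - x‖ + P * (s' - s) ≤
        (N + P) * (‖S (s' - s) x - x‖ + (s' - s)) := by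
      have := mul_nonneg hN.le hd
      have := mul_nonneg hP0.le (norm_nonneg (S (s' - s) x - x))
      linarith
    calc _ = (N * ‖S (s' - s) x - x‖ + P * (s' - s)) * Real.exp (N * K * T) := by ring
      _ ≤ ((N + P) * (‖S (s' - s) x - x‖ + (s' - s))) * Real.exp (N * K * T) := by gcongr
      _ = _ := by ring
  · intro t ht
    have hts : t ∈ Icc s T := ⟨hs'.1.trans ht.1, ht.2⟩
    have iφ := H.integrable hs hts φ hφ.1
    have i1 : IntervalIntegrable (fun τ => S (t - τ) (F τ (φ τ))) volume s s' := by
      apply iφ.mono_set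
      rw [uIcc_of_le hs'.1, uIcc_of_le hts.1]
      exact Icc_subset_Icc_right ht.1
    have i2 : IntervalIntegrable (fun τ => S (t - τ) (F τ (φ τ))) volume s' t := by
      apply iφ.mono_set
      rw [uIcc_of_le ht.1, uIcc_of_le hts.1]
      exact Icc_subset_Icc_left hs'.1
    have e1 : S (t - s) x = S (t - s') (S (s' - s) x) := by
      have := H.hSadd (t - s') (s' - s) (by linarith [ht.1]) hd
      rw [sub_add_sub_cancel] at this
      rw [this]; rfl
    simp only [map_sub]
    rw [intervalIntegral.integral_sub i2 (H.integrable hs0 ht ψ hψ.1),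
      hφ.2 t hts, hψ.2 t ht, ← intervalIntegral.integral_add_adjacent_intervals i1 i2, e1]
    abel
  · intro t ht
    refine (norm_add_le _ _).trans (add_le_add ?_ (H.piece hs hφ hs'.1 ht.1 ht.2))
    refine ((S (t - s')).le_opNorm _).trans ?_
    gcongr
    apply H.hSN
    constructor <;> linarith [ht.1, ht.2, hs.1, hs'.1]
  · filter_upwards [H.hFl] with τ hτ hm
    simpa using hτ ⟨hs0.1.trans hm.1, hm.2⟩ _ _

end

section
variable {X : Type*} [NormedAddCommGroup X] [NormedSpace ℝ X]
    {T N K : ℝ} {S : ℝ → X →L[ℝ] X} {F : ℝ → X → X}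

theorem AuxSetup.flow_cont (H : AuxSetup T N K S F) (Φ : ℝ → ℝ → X → X)
    (hΦ : ∀ s ∈ Set.Icc (0:ℝ) T, ∀ x : X, IsMildSol T S F s x (fun t => Φ s t x)) :
    ContinuousOn (fun p : (ℝ × ℝ) × X => Φ p.1.1 p.1.2 p.2)
        (({q : ℝ × ℝ | q.1 ∈ Set.Icc (0:ℝ) T ∧ q.2 ∈ Set.Icc (0:ℝ) T ∧ q.1 ≤ q.2}) ×ˢ
          (Set.univ : Set X)) := by
  have hN := H.hN
  rintro ⟨⟨s0, t0⟩, x0⟩ ⟨⟨hs0, ht0, hst0⟩, -⟩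
  simp only at hs0 ht0 hst0
  obtain ⟨C1, hC1, h1⟩ := H.start x0
  obtain ⟨C2, hC2, h2⟩ := H.shift x0
  set L := N * Real.exp (N * K * T) with hL
  let ω : ℝ → ℝ := fun r => ‖S |r| x0 - x0‖ + |r|
  have hω0 : ω 0 = 0 := by simp [ω, H.hS0]
  have hωn : ∀ r, 0 ≤ ω r := fun r => by positivity
  have hωc : Continuous ω := by
    have : Continuous (fun r : ℝ => S |r| x0) :=
      (H.hScont x0).comp_continuous continuous_abs (fun r => abs_nonneg r)
    exact (this.sub continuous_const).norm.add continuous_abs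
  set Δ := (({q : ℝ × ℝ | q.1 ∈ Set.Icc (0:ℝ) T ∧ q.2 ∈ Set.Icc (0:ℝ) T ∧ q.1 ≤ q.2}) ×ˢ
          (Set.univ : Set X)) with hΔ
  let g : (ℝ × ℝ) × X → ℝ := fun p => L * ‖p.2 - x0‖ + (C1 + 1 + C2) *
    (ω (p.1.1 - s0) + ω (min p.1.2 s0 - p.1.1)) + ‖Φ s0 (max s0 p.1.2) x0 - Φ s0 t0 x0‖
  have hinit : Φ s0 s0 x0 = x0 := by
    have := (hΦ s0 hs0 x0).2 s0 ⟨le_rfl, hs0.2⟩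
    simpa [H.hS0] using this
  have hgc : ContinuousWithinAt g Δ ((s0, t0), x0) := by
    have c1 : ContinuousWithinAt (fun p : (ℝ × ℝ) × X => Φ s0 (max s0 p.1.2) x0) Δ
        ((s0, t0), x0) := by
      have hc := (hΦ s0 hs0 x0).1 (max s0 t0) ⟨le_max_left _ _, max_le hs0.2 ht0.2⟩
      refine ContinuousWithinAt.comp (t := Icc s0 T)
        (f := fun p : (ℝ × ℝ) × X => max s0 p.1.2) (g := fun t => Φ s0 t x0) hc
        (by fun_prop) ?_
      rintro ⟨⟨s, t⟩, x⟩ ⟨⟨hs, ht, hst⟩, -⟩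
      exact ⟨le_max_left _ _, max_le hs0.2 ht.2⟩
    have c2 : Continuous (fun p : (ℝ × ℝ) × X => L * ‖p.2 - x0‖ + (C1 + 1 + C2) *
      (ω (p.1.1 - s0) + ω (min p.1.2 s0 - p.1.1))) := by fun_prop
    exact c2.continuousWithinAt.add (c1.sub continuousWithinAt_const).norm
  have hg0 : g ((s0, t0), x0) = 0 := by
    simp [g, min_eq_right hst0, max_eq_right hst0, hω0]
  have hgt : Filter.Tendsto g (nhdsWithin ((s0, t0), x0) Δ) (nhds 0) := by
    have := hgc.tendsto; rwa [hg0] at this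
  rw [ContinuousWithinAt, tendsto_iff_norm_sub_tendsto_zero]
  refine squeeze_zero' (Filter.Eventually.of_forall fun _ => norm_nonneg _) ?_ hgt
  filter_upwards [self_mem_nhdsWithin]
  rintro ⟨⟨s, t⟩, x⟩ ⟨⟨hs, ht, hst⟩, -⟩
  simp only at hs ht hst
  simp only [g]
  have a1 : ‖Φ s t x - Φ s t x0‖ ≤ L * ‖x - x0‖ :=
    H.lip hs (hΦ s hs x) (hΦ s hs x0) t ⟨hst, ht.2⟩
  have a2 : ‖Φ s t x0 - Φ s0 (max s0 t) x0‖ ≤ (C1 + 1 + C2) *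
      (ω (s - s0) + ω (min t s0 - s)) := by
    have w1 := hωn (s - s0)
    have w2 := hωn (min t s0 - s)
    have hp1 := mul_nonneg hC1 w1
    have hp2 := mul_nonneg hC1 w2
    have hp3 := mul_nonneg hC2 w1
    have hp4 := mul_nonneg hC2 w2
    rcases le_total s0 t with h | h
    · rw [max_eq_right h]
      rcases le_total s s0 with h' | h'
      · have := h2 s hs s0 ⟨h', hs0.2⟩ _ _ (hΦ s hs x0) (hΦ s0 hs0 x0) t ⟨h, ht.2⟩
        have e : ‖S (s0 - s) x0 - x0‖ + (s0 - s) = ω (s - s0) := by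
          simp only [ω]; rw [abs_sub_comm, abs_of_nonneg (by linarith)]
        rw [e] at this
        linarith
      · have := h2 s0 hs0 s ⟨h', hs.2⟩ _ _ (hΦ s0 hs0 x0) (hΦ s hs x0) t ⟨hst, ht.2⟩
        have e : ‖S (s - s0) x0 - x0‖ + (s - s0) = ω (s - s0) := by
          simp only [ω]; rw [abs_of_nonneg (by linarith)]
        rw [e, norm_sub_rev] at this
        linarith
    · rw [max_eq_left h, hinit]
      rw [min_eq_left h] at *
      have := h1 s hs _ (hΦ s hs x0) t ⟨hst, ht.2⟩
      have e : ω (t - s) = ‖S (t - s) x0 - x0‖ + (t - s) := by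
        simp only [ω]; rw [abs_of_nonneg (by linarith)]
      have : ‖S (t - s) x0 - x0‖ + C1 * (t - s) ≤ (1 + C1) * ω (t - s) := by
        rw [e]
        have := mul_nonneg hC1 (norm_nonneg (S (t - s) x0 - x0))
        linarith
      linarith
  calc ‖Φ s t x - Φ s0 t0 x0‖ = ‖(Φ s t x - Φ s t x0) + (Φ s t x0 - Φ s0 (max s0 t) x0)
        + (Φ s0 (max s0 t) x0 - Φ s0 t0 x0)‖ := by congr 1; abel
    _ ≤ _ := (norm_add₃_le).trans (by gcongr)

theorem AuxSetup.main [CompleteSpace X] (H : AuxSetup T N K S F) (Φ : ℝ → ℝ → X → X)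
    (hΦ : ∀ s ∈ Set.Icc (0:ℝ) T, ∀ x : X, IsMildSol T S F s x (fun t => Φ s t x)) (h : X) :
    ContinuousOn (fun p : (ℝ × ℝ) × X => fderiv ℝ (Φ p.1.1 p.1.2) p.2 h)
        (({q : ℝ × ℝ | q.1 ∈ Set.Icc (0:ℝ) T ∧ q.2 ∈ Set.Icc (0:ℝ) T ∧ q.1 ≤ q.2}) ×ˢ
          (Set.univ : Set X)) := by
  obtain ⟨C, hC⟩ : ∃ C : ℝ, C =
    N * (K * (N * Real.exp (N * K * T)) ^ 2) * T * Real.exp (N * K * T) := ⟨_, rfl⟩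
  have hder : ∀ s ∈ Icc (0:ℝ) T, ∀ t ∈ Icc s T, ∀ x k,
      ‖Φ s t (x + k) - Φ s t x - fderiv ℝ (Φ s t) x k‖ ≤ 3 * C * ‖k‖ ^ 2 := by
    intro s hs t ht x
    obtain ⟨J, hJ⟩ := aux_linear (fun k => Φ s t (x + k) - Φ s t x)
      (L := N * Real.exp (N * K * T)) (C := C)
      (fun k => by
        have := H.lip hs (hΦ s hs (x + k)) (hΦ s hs x) t ht
        rwa [add_sub_cancel_left] at this)
      (fun a b h k => by
        rw [hC]
        exact H.quad hs (hΦ s hs x) (hΦ s hs _) (hΦ s hs _) (hΦ s hs _) t ht)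
    have hJd : HasFDerivAt (Φ s t) J x := by
      rw [hasFDerivAt_iff_isLittleO_nhds_zero]
      refine Asymptotics.IsBigO.trans_isLittleO (g := fun k : X => ‖k‖ ^ 2) ?_
        (Asymptotics.isLittleO_norm_pow_id one_lt_two)
      refine Asymptotics.IsBigO.of_bound (3 * C) (Filter.Eventually.of_forall fun k => ?_)
      rw [norm_pow, norm_norm]
      exact hJ k
    rw [hJd.fderiv]
    exact hJ
  set Δ := (({q : ℝ × ℝ | q.1 ∈ Set.Icc (0:ℝ) T ∧ q.2 ∈ Set.Icc (0:ℝ) T ∧ q.1 ≤ q.2}) ×ˢ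
          (Set.univ : Set X)) with hΔ
  have hflow := H.flow_cont Φ hΦ
  let A : ℕ → (ℝ × ℝ) × X → X := fun n p =>
    ((n : ℝ) + 1) • (Φ p.1.1 p.1.2 (p.2 + (1 / ((n : ℝ) + 1)) • h) - Φ p.1.1 p.1.2 p.2)
  have hA : ∀ n, ContinuousOn (A n) Δ := by
    intro n
    refine ContinuousOn.const_smul (ContinuousOn.sub ?_ hflow) _
    exact hflow.comp (f := fun p : (ℝ × ℝ) × X => (p.1, p.2 + (1 / ((n : ℝ) + 1)) • h))
      (by fun_prop) (fun p hp => ⟨hp.1, mem_univ _⟩)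
  refine TendstoUniformlyOn.continuousOn (F := A) (p := Filter.atTop) ?_
    (Filter.Eventually.of_forall hA).frequently
  rw [Metric.tendstoUniformlyOn_iff]
  intro ε hε
  have hlim : Filter.Tendsto (fun n : ℕ => 3 * C * ‖h‖ ^ 2 * (1 / ((n : ℝ) + 1)))
      Filter.atTop (nhds 0) := by
    have := (tendsto_one_div_add_atTop_nhds_zero_nat (𝕜 := ℝ)).const_mul (3 * C * ‖h‖ ^ 2)
    rwa [mul_zero] at this
  filter_upwards [hlim.eventually (gt_mem_nhds hε)] with n hn
  rintro ⟨⟨s, t⟩, x⟩ ⟨⟨hs, ht, hst⟩, -⟩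
  simp only at hs ht hst
  refine lt_of_le_of_lt ?_ hn
  rw [dist_comm, dist_eq_norm]
  have hpos : (0:ℝ) < (n : ℝ) + 1 := by positivity
  have hb := hder s hs t ⟨hst, ht.2⟩ x ((1 / ((n : ℝ) + 1)) • h)
  have e : A n ((s, t), x) - fderiv ℝ (Φ s t) x h = ((n : ℝ) + 1) •
      (Φ s t (x + (1 / ((n : ℝ) + 1)) • h) - Φ s t x
        - fderiv ℝ (Φ s t) x ((1 / ((n : ℝ) + 1)) • h)) := by
    simp only [A]
    rw [smul_sub _ _ (fderiv ℝ (Φ s t) x _), map_smul, smul_smul, mul_one_div_cancel hpos.ne',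
      one_smul]
  simp only
  rw [e, norm_smul, Real.norm_of_nonneg hpos.le]
  refine (mul_le_mul_of_nonneg_left hb hpos.le).trans (le_of_eq ?_)
  rw [norm_smul, Real.norm_of_nonneg (by positivity)]
  field_simp

end

/-- under (A) and (A+), with `J_{s,t}(x) = D_xΦ̄_{s,t}(x)`, for every `h ∈ X`
the map `(s, t, x) ↦ J_{s,t}(x) h` is continuous from `Δ × X` to `X`. -/
theorem mild_flow_derivative_continuous
    {X : Type*} [NormedAddCommGroup X] [NormedSpace ℝ X] [CompleteSpace X]
    {m : ℕ} {T : ℝ} (hT : 0 < T)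
    (S : ℝ → X →L[ℝ] X)
    (hS0 : S 0 = ContinuousLinearMap.id ℝ X)
    (hSadd : ∀ a b : ℝ, 0 ≤ a → 0 ≤ b → S (a + b) = (S a).comp (S b))
    (hScont : ∀ x : X, ContinuousOn (fun σ => S σ x) (Set.Ici (0 : ℝ)))
    (U : Set (EuclideanSpace ℝ (Fin m))) (hUcpt : IsCompact U) (hUcvx : Convex ℝ U)
    (f : ℝ → X → X) (G : ℝ → X → EuclideanSpace ℝ (Fin m) →L[ℝ] X)
    {Mf MG : ℝ} (hMf : 0 ≤ Mf) (hMG : 0 ≤ MG)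
    (hfmeas : ∀ x : X,
      AEStronglyMeasurable (fun t => f t x) (volume.restrict (Set.Icc (0:ℝ) T)))
    (hGmeas : ∀ x : X,
      AEStronglyMeasurable (fun t => G t x) (volume.restrict (Set.Icc (0:ℝ) T)))
    (hA : ∀ᵐ t ∂(volume.restrict (Set.Icc (0:ℝ) T)),
        (∀ x y : X, ‖f t x - f t y‖ ≤ Mf * ‖x - y‖) ∧
        (∀ x y : X, ‖G t x - G t y‖ ≤ MG * ‖x - y‖) ∧
        ‖f t 0‖ ≤ Mf ∧ ‖G t 0‖ ≤ MG)
    {M : ℝ} (hM : 0 ≤ M)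
    (hDfmeas : ∀ x : X,
      AEStronglyMeasurable (fun t => fderiv ℝ (f t) x) (volume.restrict (Set.Icc (0:ℝ) T)))
    (hDGmeas : ∀ x : X,
      AEStronglyMeasurable (fun t => fderiv ℝ (G t) x) (volume.restrict (Set.Icc (0:ℝ) T)))
    (hAplus : ∀ᵐ t ∂(volume.restrict (Set.Icc (0:ℝ) T)),
        ContDiff ℝ 1 (f t) ∧ ContDiff ℝ 1 (G t) ∧
        (∀ x : X, ‖fderiv ℝ (f t) x‖ ≤ M) ∧
        (∀ x : X, ‖fderiv ℝ (G t) x‖ ≤ M) ∧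
        (∀ x y : X, ‖fderiv ℝ (f t) x - fderiv ℝ (f t) y‖ ≤ M * ‖x - y‖) ∧
        (∀ x y : X, ‖fderiv ℝ (G t) x - fderiv ℝ (G t) y‖ ≤ M * ‖x - y‖))
    (ubar : ℝ → EuclideanSpace ℝ (Fin m))
    (hubar_meas : AEStronglyMeasurable ubar (volume.restrict (Set.Icc (0:ℝ) T)))
    (hubar_mem : ∀ᵐ t ∂(volume.restrict (Set.Icc (0:ℝ) T)), ubar t ∈ U)
    (Φ : ℝ → ℝ → X → X)
    (hΦ : ∀ s ∈ Set.Icc (0:ℝ) T, ∀ x : X,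
      IsMildSol T S (fun τ y => f τ y + G τ y (ubar τ)) s x (fun t => Φ s t x)) :
    ∀ h : X,
      ContinuousOn (fun p : (ℝ × ℝ) × X => fderiv ℝ (Φ p.1.1 p.1.2) p.2 h)
        (({q : ℝ × ℝ | q.1 ∈ Set.Icc (0:ℝ) T ∧ q.2 ∈ Set.Icc (0:ℝ) T ∧ q.1 ≤ q.2}) ×ˢ
          (Set.univ : Set X)) := by
  obtain ⟨N0, hN0⟩ : ∃ N0, ∀ σ : Icc (0:ℝ) T, ‖S σ‖ ≤ N0 := by
    apply banach_steinhaus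
    intro x
    obtain ⟨B, hB⟩ := (isCompact_Icc.image_of_continuousOn
      ((hScont x).mono (Icc_subset_Ici_self : Icc (0:ℝ) T ⊆ _)).norm).bddAbove
    exact ⟨B, fun σ => hB (mem_image_of_mem _ σ.2)⟩
  obtain ⟨R0, hR0⟩ := hUcpt.isBounded.exists_norm_le
  set R := max R0 0 with hRdef
  have hR : 0 ≤ R := le_max_right _ _
  have hu : ∀ᵐ t, t ∈ Icc (0:ℝ) T → ‖ubar t‖ ≤ R := by
    rw [ae_restrict_iff' measurableSet_Icc] at hubar_mem
    filter_upwards [hubar_mem] with t ht hm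
    exact (hR0 _ (ht hm)).trans (le_max_left _ _)
  rw [ae_restrict_iff' measurableSet_Icc] at hA hAplus
  set F : ℝ → X → X := fun τ y => f τ y + G τ y (ubar τ) with hF
  set K := 1 + Mf + MG * R + M + M * R with hK
  have p1 : 0 ≤ MG * R := by positivity
  have p2 : 0 ≤ M * R := by positivity
  have hlip : ∀ᵐ t, t ∈ Icc (0:ℝ) T → ∀ x y, ‖F t x - F t y‖ ≤ (Mf + MG * R) * ‖x - y‖ := by
    filter_upwards [hA, hu] with t h1 h2 hm x y
    obtain ⟨a1, a2, -, -⟩ := h1 hm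
    have h2 := h2 hm
    have e : F t x - F t y = (f t x - f t y) + (G t x - G t y) (ubar t) := by
      simp only [hF, ContinuousLinearMap.sub_apply]; abel
    rw [e, add_mul]
    refine (norm_add_le _ _).trans (add_le_add (a1 x y) ?_)
    calc _ ≤ ‖G t x - G t y‖ * ‖ubar t‖ := ContinuousLinearMap.le_opNorm _ _
      _ ≤ (MG * ‖x - y‖) * R := by
        gcongr
        exact a2 x y
      _ = _ := by ring
  have H : AuxSetup T (max N0 1) K S F :=
    { hT := hT
      hN := lt_of_lt_of_le one_pos (le_max_right _ _)
      hK := by linarith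
      hS0 := hS0
      hSadd := hSadd
      hScont := hScont
      hSN := fun σ hσ => (hN0 ⟨σ, hσ⟩).trans (le_max_left _ _)
      hFm := fun x => (hfmeas x).add (aux_carath (fun τ v => G τ x v)
        (fun v => (ContinuousLinearMap.apply ℝ X v).continuous.comp_aestronglyMeasurable (hGmeas x))
        (Filter.Eventually.of_forall fun τ => (G τ x).continuous) ubar hubar_meas)
      hFl := by
        filter_upwards [hlip] with t h1 hm x y
        refine (h1 hm x y).trans ?_
        gcongr
        linarith
      hFb := by
        filter_upwards [hlip, hA, hu] with t h1 h2 h3 hm x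
        obtain ⟨-, -, a3, a4⟩ := h2 hm
        have b1 := h1 hm x 0
        rw [sub_zero] at b1
        have b2 : ‖F t 0‖ ≤ Mf + MG * R := by
          refine (norm_add_le _ _).trans (add_le_add a3 ?_)
          refine (ContinuousLinearMap.le_opNorm _ _).trans ?_
          gcongr
          exact h3 hm
        have b3 : ‖F t x‖ ≤ ‖F t x - F t 0‖ + ‖F t 0‖ := by
          simpa using norm_add_le (F t x - F t 0) (F t 0)
        have b4 : (Mf + MG * R) * ‖x‖ ≤ K * ‖x‖ := by
          gcongr
          linarith
        linarith
      hFd := by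
        filter_upwards [hAplus, hu] with t h1 h2 hm x
        obtain ⟨c1, c2, c3, c4, c5, c6⟩ := h1 hm
        have h2 := h2 hm
        refine ⟨fderiv ℝ (f t) x + (fderiv ℝ (G t) x).flip (ubar t), ?_, fun d => ?_⟩
        · have : ‖(fderiv ℝ (G t) x).flip (ubar t)‖ ≤ M * R := by
            refine (ContinuousLinearMap.le_opNorm _ _).trans ?_
            rw [ContinuousLinearMap.opNorm_flip]
            gcongr
            exact c4 x
          have := norm_add_le (fderiv ℝ (f t) x) ((fderiv ℝ (G t) x).flip (ubar t))
          linarith [c3 x]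
        · have d1 := aux_second_order (c1.differentiable (by norm_num)) hM c5 x d
          have d2 := aux_second_order (c2.differentiable (by norm_num)) hM c6 x d
          have e : F t (x + d) - F t x
              - (fderiv ℝ (f t) x + (fderiv ℝ (G t) x).flip (ubar t)) d
              = (f t (x + d) - f t x - fderiv ℝ (f t) x d)
                + (G t (x + d) - G t x - fderiv ℝ (G t) x d) (ubar t) := by
            simp only [hF, ContinuousLinearMap.sub_apply, ContinuousLinearMap.add_apply,
              ContinuousLinearMap.flip_apply]
            abel
          rw [e]
          have d3 : ‖(G t (x + d) - G t x - fderiv ℝ (G t) x d) (ubar t)‖ ≤ M * ‖d‖ ^ 2 * R := by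
            refine (ContinuousLinearMap.le_opNorm _ _).trans ?_
            gcongr
          refine (norm_add_le _ _).trans ?_
          have d4 : (M + M * R) * ‖d‖ ^ 2 ≤ K * ‖d‖ ^ 2 := by
            gcongr
            linarith
          linarith }
  exact fun h => H.main Φ hΦ h
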